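/- If (n, m, a) is a solution in nonnegative integers of L_n + L_m = 3^a with n > m and n > 200, then a ≤ n + 2 < 1.2×10^{20}. -/

import Mathlib

/-- The Lucas sequence: `L 0 = 2`, `L 1 = 1`, `L (n+2) = L (n+1) + L n`. -/
def lucas : ℕ → ℕ
  | 0 => 2
  | 1 => 1
  | n + 2 => lucas (n + 1) + lucas n

theorem le_lucas_aux (n : ℕ) : n ≤ lucas n ∧ n + 1 ≤ lucas (n + 1) := by
  induction n with
  | zero => simp [lucas]
  | succ k ih =>
    refine ⟨ih.2, ?_⟩
    rcases k with _ | k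
    · simp [lucas]
    · have : lucas (k + 1 + 1 + 1) = lucas (k + 1 + 1) + lucas (k + 1) := rfl
      omega

/-- `gen k a b` lists `k` consecutive terms, modulo `27 * 361760`. -/
def lucasGen : ℕ → ℕ → ℕ → List ℕ
  | 0, _, _ => []
  | k + 1, a, b => a :: lucasGen k b ((a + b) % 9767520)

/-- Powers of three modulo `361760 = 32 * 5 * 7 * 17 * 19`. -/
def powGen : ℕ → ℕ → List ℕ
  | 0, _ => []
  | k + 1, a => a :: powGen k (3 * a % 361760)

theorem lucasGen_mem (k i j : ℕ) (hi : i < k) :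
    lucas (j + i) % 9767520 ∈
      lucasGen k (lucas j % 9767520) (lucas (j + 1) % 9767520) := by
  induction k generalizing i j with
  | zero => omega
  | succ k ih =>
    rcases i with _ | i
    · simp [lucasGen]
    · have h1 := ih i (j + 1) (by omega)
      have h2 : (lucas j % 9767520 + lucas (j + 1) % 9767520) % 9767520
          = lucas (j + 1 + 1) % 9767520 := by
        have : lucas (j + 1 + 1) = lucas (j + 1) + lucas j := rfl
        omega
      rw [lucasGen, h2, show j + (i + 1) = j + 1 + i by ring]
      exact List.mem_cons_of_mem _ h1

theorem powGen_mem (k i j : ℕ) (hi : i < k) :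
    3 ^ (j + i) % 361760 ∈ powGen k (3 ^ j % 361760) := by
  induction k generalizing i j with
  | zero => omega
  | succ k ih =>
    rcases i with _ | i
    · simp [powGen]
    · have h1 := ih i (j + 1) (by omega)
      have h2 : 3 * (3 ^ j % 361760) % 361760 = 3 ^ (j + 1) % 361760 := by
        have : 3 ^ (j + 1) = 3 * 3 ^ j := by ring
        omega
      rw [powGen, h2, show j + (i + 1) = j + 1 + i by ring]
      exact List.mem_cons_of_mem _ h1

theorem lucas_shift (k n : ℕ) :
    lucas (n + k + 1) = Nat.fib (k + 1) * lucas (n + 1) + Nat.fib k * lucas n ∧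
    lucas (n + k + 2) = Nat.fib (k + 2) * lucas (n + 1) + Nat.fib (k + 1) * lucas n := by
  induction k with
  | zero => simp [lucas]
  | succ k ih =>
    obtain ⟨h1, h2⟩ := ih
    refine ⟨h2, ?_⟩
    have h3 : lucas (n + (k + 1) + 2) = lucas (n + k + 2) + lucas (n + k + 1) := rfl
    have f1 : Nat.fib (k + 1 + 2) = Nat.fib (k + 1) + Nat.fib (k + 2) := Nat.fib_add_two
    have f2 : Nat.fib (k + 2) = Nat.fib k + Nat.fib (k + 1) := Nat.fib_add_two
    rw [h3, h1, h2, f1, show k + 1 + 1 = k + 2 from rfl, f2]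
    ring

theorem lucas_period_aux (n : ℕ) : lucas (n + 144) % 9767520 = lucas n % 9767520 ∧
    lucas (n + 1 + 144) % 9767520 = lucas (n + 1) % 9767520 := by
  induction n with
  | zero =>
    constructor
    · have h := (lucas_shift 143 0).1
      norm_num [lucas] at h
      norm_num [lucas, h]
    · have h := (lucas_shift 144 0).1
      norm_num [lucas] at h
      norm_num [lucas, h]
  | succ k ih =>
    refine ⟨ih.2, ?_⟩
    have h1 : lucas (k + 1 + 1 + 144) = lucas (k + 1 + 144) + lucas (k + 144) := rfl
    have h2 : lucas (k + 1 + 1) = lucas (k + 1) + lucas k := rfl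
    omega

theorem lucas_period (n : ℕ) : lucas (n + 144) % 9767520 = lucas n % 9767520 :=
  (lucas_period_aux n).1

theorem lucas_mod_mem (n : ℕ) : lucas n % 9767520 ∈ lucasGen 144 2 1 := by
  have h : ∀ q r, lucas (r + 144 * q) % 9767520 = lucas r % 9767520 := by
    intro q
    induction q with
    | zero => simp
    | succ q ih =>
      intro r
      rw [show r + 144 * (q + 1) = (r + 144 * q) + 144 by ring, lucas_period, ih]
  have h1 := h (n / 144) (n % 144)
  rw [Nat.mod_add_div] at h1
  rw [h1]
  have := lucasGen_mem 144 (n % 144) 0 (Nat.mod_lt _ (by norm_num))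
  simpa [lucas] using this

theorem pow_mod_mem (a : ℕ) : 3 ^ a % 361760 ∈ powGen 144 1 := by
  have h1 : 3 ^ a % 361760 = 3 ^ (a % 144) % 361760 := by
    conv_lhs => rw [← Nat.mod_add_div a 144, pow_add, pow_mul, Nat.mul_mod, Nat.pow_mod (3 ^ 144)]
    norm_num
  rw [h1]
  have := powGen_mem 144 (a % 144) 0 (Nat.mod_lt _ (by norm_num))
  simpa using this

theorem sieve :
    ((lucasGen 144 2 1).all fun x => (lucasGen 144 2 1).all fun y =>
      !(Nat.beq ((x + y) % 27) 0) ||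
        (powGen 144 1).all fun z => !(Nat.beq ((x + y) % 361760) z)) = true := by
  decide +kernel

theorem no_solution (n m a : ℕ) (ha : 3 ≤ a) (h : lucas n + lucas m = 3 ^ a) : False := by
  have hs := sieve
  rw [List.all_eq_true] at hs
  have h1 := hs _ (lucas_mod_mem n)
  rw [List.all_eq_true] at h1
  have h2 := h1 _ (lucas_mod_mem m)
  have e27 : (lucas n % 9767520 + lucas m % 9767520) % 27 = 0 := by
    obtain ⟨b, rfl⟩ := Nat.exists_eq_add_of_le ha
    rw [pow_add] at h
    omega
  have eM : (lucas n % 9767520 + lucas m % 9767520) % 361760 = 3 ^ a % 361760 := by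
    omega
  rw [e27, eM] at h2
  have h3 : (powGen 144 1).all (fun z => !(Nat.beq (3 ^ a % 361760) z)) = true := by
    simpa using h2
  rw [List.all_eq_true] at h3
  have h4 := h3 _ (pow_mod_mem a)
  simp at h4

/-- If `(n, m, a)` is a solution in nonnegative integers of `L n + L m = 3^a` with
`n > m` and `n > 200`, then `a ≤ n + 2 < 1.2×10²⁰`. -/
theorem a_le_and_n_lt (n m a : ℕ) (hnm : m < n) (hn : 200 < n)
    (h : lucas n + lucas m = 3 ^ a) :
    a ≤ n + 2 ∧ ((n : ℝ) + 2) < 1.2e20 := by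
  exfalso
  refine no_solution n m a ?_ h
  by_contra hlt
  have hb : 3 ^ a ≤ 3 ^ 2 := Nat.pow_le_pow_right (by norm_num) (by omega)
  have := (le_lucas_aux n).1
  omega
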